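/- Under the assumptions of Lemma 3.3, for any cell decomposition r in the complement set R̄_{n,ε} (violating the width condition on more than εd cells), and any η ∈ (0, γ* − δ*), for all sufficiently large n, E(Σ_{k=1}^d L(block_k(r)) − L_n) ≤ −ηεn/m. -/

import Mathlib

open MeasureTheory Filter

noncomputable def alignScore {A : Type*} {m n k : ℕ} (S : (Fin m → A) → ℝ)
    (w : Fin m → Fin n → A) (π : Fin m → Fin k → Fin n) : ℝ :=
  ∑ i : Fin k, S (fun j => w j (π j i))

noncomputable def optScore {A : Type*} (m n : ℕ) (S : (Fin m → A) → ℝ)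
    (w : Fin m → Fin n → A) : ℝ :=
  sSup {x : ℝ | ∃ (k : ℕ) (π : Fin m → Fin k → Fin n),
    (∀ j, StrictMono (π j)) ∧ x = alignScore S w π}

def PermInvariant {A : Type*} {m : ℕ} (S : (Fin m → A) → ℝ) : Prop :=
  ∀ (σ : Equiv.Perm (Fin m)) (x : Fin m → A), S (x ∘ σ) = S x

def BddDiffOne {A : Type*} {m : ℕ} (S : (Fin m → A) → ℝ) (D : ℝ) : Prop :=
  ∀ x y : Fin m → A, (∃ j₀, ∀ j, j ≠ j₀ → x j = y j) → |S x - S y| ≤ D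

noncomputable def wordMeasure {A : Type*} [MeasurableSpace A] (p : Measure A) (m n : ℕ) :
    Measure (Fin m → Fin n → A) :=
  Measure.pi fun _ => Measure.pi fun _ => p

noncomputable def expL {A : Type*} [MeasurableSpace A] (p : Measure A) (m n : ℕ)
    (S : (Fin m → A) → ℝ) : ℝ :=
  ∫ w, optScore m n S w ∂(wordMeasure p m n)

noncomputable def optScoreV {A : Type*} (m : ℕ) (ℓ : Fin m → ℕ) (S : (Fin m → A) → ℝ)
    (w : ∀ j : Fin m, Fin (ℓ j) → A) : ℝ :=
  sSup {x : ℝ | ∃ (k : ℕ) (π : ∀ j : Fin m, Fin k → Fin (ℓ j)),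
    (∀ j, StrictMono (π j)) ∧ x = ∑ i : Fin k, S (fun j => w j (π j i))}

noncomputable def wordMeasureV {A : Type*} [MeasurableSpace A] (p : Measure A) {m : ℕ}
    (ℓ : Fin m → ℕ) : Measure (∀ j : Fin m, Fin (ℓ j) → A) :=
  Measure.pi fun _ => Measure.pi fun _ => p

noncomputable def expLV {A : Type*} [MeasurableSpace A] (p : Measure A) {m : ℕ}
    (ℓ : Fin m → ℕ) (S : (Fin m → A) → ℝ) : ℝ :=
  ∫ w, optScoreV m ℓ S w ∂(wordMeasureV p ℓ)

noncomputable def blockScore {A : Type*} {m n : ℕ} (S : (Fin m → A) → ℝ)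
    (w : Fin m → Fin n → A) (lo hi : Fin m → ℕ) : ℝ :=
  sSup {x : ℝ | ∃ (k : ℕ) (π : Fin m → Fin k → Fin n),
    (∀ j, StrictMono (π j)) ∧ (∀ j i, lo j ≤ (π j i : ℕ) ∧ (π j i : ℕ) < hi j) ∧
    x = ∑ i : Fin k, S (fun j => w j (π j i))}

open scoped Classical

def IsDecomp (m n d v : ℕ) (r : Fin m → ℕ → ℕ) : Prop :=
  (∀ j : Fin m, (j : ℕ) = 0 → ∀ k, r j k = v * k) ∧
  ∀ j : Fin m, Monotone (r j) ∧ r j 0 = 0 ∧ r j d = n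

noncomputable def decompScore {A : Type*} {m n : ℕ} (S : (Fin m → A) → ℝ)
    (w : Fin m → Fin n → A) (d : ℕ) (r : Fin m → ℕ → ℕ) : ℝ :=
  ∑ k ∈ Finset.range d, blockScore S w (fun j => r j k) (fun j => r j (k + 1))

def GoodCell (m v : ℕ) (p1 p2 : Fin m → ℝ) (r : Fin m → ℕ → ℕ) (k : ℕ) : Prop :=
  ∀ j : Fin m, (j : ℕ) ≠ 0 →
    (v : ℝ) * p1 j ≤ (r j (k + 1) : ℝ) - (r j k : ℝ) ∧
    (r j (k + 1) : ℝ) - (r j k : ℝ) ≤ (v : ℝ) * p2 j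

/-- The set of candidate scores behind `optScoreV`. -/
def candV {A : Type*} (m : ℕ) (ℓ : Fin m → ℕ) (S : (Fin m → A) → ℝ)
    (w : ∀ j : Fin m, Fin (ℓ j) → A) : Set ℝ :=
  {x : ℝ | ∃ (k : ℕ) (π : ∀ j : Fin m, Fin k → Fin (ℓ j)),
    (∀ j, StrictMono (π j)) ∧ x = ∑ i : Fin k, S (fun j => w j (π j i))}

lemma optScoreV_eq {A : Type*} (m : ℕ) (ℓ : Fin m → ℕ) (S : (Fin m → A) → ℝ)
    (w : ∀ j : Fin m, Fin (ℓ j) → A) : optScoreV m ℓ S w = sSup (candV m ℓ S w) := rfl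

lemma zero_mem_candV {A : Type*} (m : ℕ) (ℓ : Fin m → ℕ) (S : (Fin m → A) → ℝ)
    (w : ∀ j : Fin m, Fin (ℓ j) → A) : (0 : ℝ) ∈ candV m ℓ S w :=
  ⟨0, fun j i => i.elim0, fun j i => i.elim0, by simp⟩

lemma candV_le {A : Type*} {m : ℕ} {ℓ : Fin m → ℕ} {S : (Fin m → A) → ℝ}
    {s : ℝ} (hSb : ∀ x, S x ≤ s) (hs : 0 ≤ s)
    {w : ∀ j : Fin m, Fin (ℓ j) → A} (j : Fin m) {x : ℝ} (hx : x ∈ candV m ℓ S w) :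
    x ≤ ℓ j * s := by
  obtain ⟨k, π, hπ, rfl⟩ := hx
  have hk : k ≤ ℓ j := by
    simpa using Fintype.card_le_of_injective _ (hπ j).injective
  calc ∑ i : Fin k, S (fun j => w j (π j i)) ≤ ∑ i : Fin k, s := Finset.sum_le_sum fun i _ => hSb _
    _ = k * s := by simp
    _ ≤ ℓ j * s := by gcongr

lemma candV_bdd {A : Type*} {m : ℕ} {ℓ : Fin m → ℕ} {S : (Fin m → A) → ℝ}
    (hS0 : ∀ x, 0 ≤ S x) {s : ℝ} (hSb : ∀ x, S x ≤ s) (hs : 0 ≤ s) (j : Fin m)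
    (w : ∀ j : Fin m, Fin (ℓ j) → A) : BddAbove (candV m ℓ S w) :=
  ⟨_, fun _ hx => candV_le hSb hs j hx⟩

lemma optScoreV_nonneg {A : Type*} {m : ℕ} {ℓ : Fin m → ℕ} {S : (Fin m → A) → ℝ}
    (hS0 : ∀ x, 0 ≤ S x) (w : ∀ j : Fin m, Fin (ℓ j) → A) : 0 ≤ optScoreV m ℓ S w := by
  apply Real.sSup_nonneg
  rintro x ⟨k, π, hπ, rfl⟩
  exact Finset.sum_nonneg fun i _ => hS0 _

lemma optScoreV_le {A : Type*} {m : ℕ} {ℓ : Fin m → ℕ} {S : (Fin m → A) → ℝ}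
    (hS0 : ∀ x, 0 ≤ S x) {s : ℝ} (hSb : ∀ x, S x ≤ s) (hs : 0 ≤ s) (j : Fin m)
    (w : ∀ j : Fin m, Fin (ℓ j) → A) : optScoreV m ℓ S w ≤ ℓ j * s :=
  csSup_le ⟨0, zero_mem_candV m ℓ S w⟩ fun _ hx => candV_le hSb hs j hx

lemma append_sm {a b k k' : ℕ} {π : Fin k → Fin a} {π' : Fin k' → Fin b} (h1 : StrictMono π)
    (h2 : StrictMono π') : StrictMono (Fin.append (fun i => Fin.castAdd b (π i))
      (fun i => Fin.natAdd a (π' i))) := by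
  intro i i' h
  induction i using Fin.addCases with
  | left i =>
    induction i' using Fin.addCases with
    | left i' =>
      have h2 : i < i' := by rw [Fin.lt_def] at h ⊢; simpa using h
      have := h1 h2
      rw [Fin.append_left, Fin.append_left, Fin.lt_def]
      exact this
    | right i' =>
      rw [Fin.append_left, Fin.append_right, Fin.lt_def]
      simp only [Fin.val_castAdd, Fin.val_natAdd]
      omega
  | right i =>
    induction i' using Fin.addCases with
    | left i' =>
      rw [Fin.lt_def] at h
      simp only [Fin.val_castAdd, Fin.val_natAdd] at h
      omega
    | right i' =>
      have h3 : i < i' := by rw [Fin.lt_def] at h ⊢; simpa using h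
      have := h2 h3
      rw [Fin.append_right, Fin.append_right, Fin.lt_def]
      simp only [Fin.val_natAdd]
      rw [Fin.lt_def] at this
      omega

lemma optScoreV_super {A : Type*} {m : ℕ} {a b : Fin m → ℕ} {S : (Fin m → A) → ℝ}
    (hS0 : ∀ x, 0 ≤ S x) {s : ℝ} (hSb : ∀ x, S x ≤ s) (hs : 0 ≤ s) (j₀ : Fin m)
    (w : ∀ j : Fin m, Fin (a j + b j) → A) :
    optScoreV m a S (fun j i => w j (Fin.castAdd _ i)) +
      optScoreV m b S (fun j i => w j (Fin.natAdd _ i)) ≤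
      optScoreV m (fun j => a j + b j) S w := by
  rw [optScoreV_eq m a, optScoreV_eq m b, ← le_sub_iff_add_le]
  refine csSup_le (s := candV m a S _) ⟨0, zero_mem_candV m a S _⟩ ?_
  rintro x ⟨k, π, hπ, hx⟩
  rw [le_sub_iff_add_le, add_comm, ← le_sub_iff_add_le]
  refine csSup_le (s := candV m b S _) ⟨0, zero_mem_candV m b S _⟩ ?_
  rintro y ⟨k', π', hπ', hy⟩
  rw [le_sub_iff_add_le, add_comm]
  refine le_csSup (candV_bdd hS0 hSb hs j₀ w) ?_
  refine ⟨k + k', fun j => Fin.append (fun i => Fin.castAdd _ (π j i))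
    (fun i => Fin.natAdd _ (π' j i)), ?_, ?_⟩
  · exact fun j => append_sm (hπ j) (hπ' j)
  · rw [Fin.sum_univ_add, hx, hy]
    simp

lemma blockScore_eq {A : Type*} {m n : ℕ} (S : (Fin m → A) → ℝ)
    (w : Fin m → Fin n → A) (lo hi : Fin m → ℕ) (h1 : ∀ j, lo j ≤ hi j) (h2 : ∀ j, hi j ≤ n) :
    blockScore S w lo hi = optScoreV m (fun j => hi j - lo j) S
      (fun j i => w j ⟨lo j + i, by have := h1 j; have := h2 j; have : (i : ℕ) < hi j - lo j := i.2; omega⟩) := by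
  unfold blockScore optScoreV
  congr 1
  ext x
  constructor
  · rintro ⟨k, π, hπ, hb, rfl⟩
    refine ⟨k, fun j i => ⟨(π j i : ℕ) - lo j, by have := hb j i; show _ < hi j - lo j; omega⟩, ?_, ?_⟩
    · intro j i i' h
      have := hπ j h
      rw [Fin.lt_def] at this ⊢
      have := hb j i
      have := hb j i'
      simp only
      omega
    · refine Finset.sum_congr rfl fun i _ => ?_
      congr 1
      ext j
      congr 1
      ext
      have := hb j i
      simp only
      omega
  · rintro ⟨k, π, hπ, rfl⟩
    refine ⟨k, fun j i => ⟨lo j + π j i, by have := h1 j; have := h2 j; have : (π j i : ℕ) < hi j - lo j := (π j i).2; omega⟩,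
      ?_, ?_, rfl⟩
    · intro j i i' h
      have := hπ j h
      rw [Fin.lt_def] at this ⊢
      simp only
      omega
    · intro j i
      have : (π j i : ℕ) < hi j - lo j := (π j i).2
      have := h1 j
      simp only
      omega

lemma optScore_eq {A : Type*} (m n : ℕ) (S : (Fin m → A) → ℝ) (w : Fin m → Fin n → A) :
    optScore m n S w = optScoreV m (fun _ => n) S w := rfl

lemma expL_eq {A : Type*} [MeasurableSpace A] (p : Measure A) (m n : ℕ) (S : (Fin m → A) → ℝ) :
    expL p m n S = expLV p (fun _ : Fin m => n) S := rfl

lemma optScore_const {A : Type*} {m n : ℕ} {S : (Fin m → A) → ℝ}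
    (hS0 : ∀ x, 0 ≤ S x) (j₀ : Fin m) (x : Fin m → A) :
    optScore m n S (fun j _ => x j) = n * S x := by
  apply IsGreatest.csSup_eq
  constructor
  · exact ⟨n, fun _ i => i, fun _ => strictMono_id, by simp [alignScore]⟩
  · rintro y ⟨k, π, hπ, rfl⟩
    have hk : k ≤ n := by
      simpa using Fintype.card_le_of_injective _ (hπ j₀).injective
    simp only [alignScore, Finset.sum_const, Finset.card_univ, Fintype.card_fin, nsmul_eq_mul]
    have := hS0 x
    gcongr

/-! Measure preserving reindexings -/

lemma mp_reindex {A ι κ : Type*} [Fintype ι] [Fintype κ] [MeasurableSpace A]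
    (p : Measure A) [IsProbabilityMeasure p] (f : ι → κ) (hf : Function.Injective f) :
    MeasurePreserving (fun (w : κ → A) i => w (f i)) (Measure.pi fun _ => p)
      (Measure.pi fun _ => p) := by
  have hm : Measurable (fun (w : κ → A) i => w (f i)) :=
    measurable_pi_lambda _ fun i => measurable_pi_apply _
  refine ⟨hm, ?_⟩
  symm
  refine Measure.pi_eq fun s hs => ?_
  rw [Measure.map_apply hm (MeasurableSet.univ_pi hs)]
  have : (fun (w : κ → A) i => w (f i)) ⁻¹' Set.pi Set.univ s =
      Set.pi Set.univ (fun k => {a | ∀ i, f i = k → a ∈ s i}) := by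
    ext w
    simp only [Set.mem_preimage, Set.mem_pi, Set.mem_univ, true_imp_iff, Set.mem_ofPred_eq]
    exact ⟨fun h k i hi => hi ▸ h i, fun h i => h _ i rfl⟩
  rw [this, Measure.pi_pi]
  symm
  refine Fintype.prod_of_injective f hf _ _ ?_ ?_
  · intro k hk
    have : {a | ∀ i, f i = k → a ∈ s i} = Set.univ := by
      ext a
      simp only [Set.mem_ofPred_eq, Set.mem_univ, iff_true]
      intro i hi
      exact (hk ⟨i, hi⟩).elim
    rw [this, measure_univ]
  · intro i
    congr 1
    ext a
    simp only [Set.mem_ofPred_eq]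
    constructor
    · intro h i' hi'
      rwa [hf hi']
    · intro h
      exact h i rfl

lemma mp_rows {A : Type*} [MeasurableSpace A] (p : Measure A) [IsProbabilityMeasure p]
    {m : ℕ} (a b : Fin m → ℕ) (f : ∀ j, Fin (a j) → Fin (b j))
    (hf : ∀ j, Function.Injective (f j)) :
    MeasurePreserving (fun (w : ∀ j, Fin (b j) → A) j i => w j (f j i))
      (wordMeasureV p b) (wordMeasureV p a) :=
  measurePreserving_pi _ _ fun j => mp_reindex p (f j) (hf j)

lemma mp_perm {A : Type*} [MeasurableSpace A] (p : Measure A) [IsProbabilityMeasure p]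
    {m : ℕ} (a : Fin m → ℕ) (σ : Equiv.Perm (Fin m)) :
    MeasurePreserving (fun (w : ∀ j, Fin (a j) → A) j => w (σ j))
      (wordMeasureV p a) (wordMeasureV p (fun j => a (σ j))) :=
  (measurePreserving_piCongrLeft
    (fun j => (Measure.pi fun _ => p : Measure (Fin (a j) → A))) σ).symm

instance wordMeasureV_prob {A : Type*} [MeasurableSpace A] (p : Measure A) [IsProbabilityMeasure p]
    {m : ℕ} (a : Fin m → ℕ) : IsProbabilityMeasure (wordMeasureV p a) := by
  unfold wordMeasureV; infer_instance

lemma optScoreV_perm {A : Type*} {m : ℕ} {S : (Fin m → A) → ℝ} (hSp : PermInvariant S)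
    (a : Fin m → ℕ) (σ : Equiv.Perm (Fin m)) (w : ∀ j, Fin (a j) → A) :
    optScoreV m (fun j => a (σ j)) S (fun j => w (σ j)) = optScoreV m a S w := by
  unfold optScoreV
  congr 1
  ext x
  constructor
  · rintro ⟨k, π, hπ, rfl⟩
    have key : ∀ j, ∃ q : Fin k → Fin (a j), StrictMono q ∧
        ∀ i, w j (q i) = w (σ (σ.symm j)) (π (σ.symm j) i) := by
      intro j
      obtain ⟨j, rfl⟩ := σ.surjective j
      rw [σ.symm_apply_apply]
      exact ⟨π j, hπ j, fun i => rfl⟩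
    choose q hq1 hq2 using key
    refine ⟨k, q, hq1, Finset.sum_congr rfl fun i _ => ?_⟩
    rw [← hSp σ.symm]
    congr 1
    ext j
    simp [hq2]
  · rintro ⟨k, π, hπ, rfl⟩
    refine ⟨k, fun j => π (σ j), fun j => hπ _, Finset.sum_congr rfl fun i _ => ?_⟩
    exact (hSp σ _).symm

/-! Measurability: `A` carries an arbitrary σ-algebra -/

/-- Two points that no measurable set separates. -/
def Indist {α : Type*} [MeasurableSpace α] (x y : α) : Prop :=
  ∀ s : Set α, MeasurableSet s → (x ∈ s ↔ y ∈ s)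

lemma indist_pi {ι : Type*} {α : ι → Type*} [∀ i, MeasurableSpace (α i)] {x y : ∀ i, α i}
    (h : ∀ i, Indist (x i) (y i)) : Indist x y := by
  let M : MeasurableSpace (∀ i, α i) :=
    { MeasurableSet' := fun s => x ∈ s ↔ y ∈ s
      measurableSet_empty := by simp
      measurableSet_compl := fun s hs => by simp [hs]
      measurableSet_iUnion := fun f hf => by simp [hf] }
  have hle : MeasurableSpace.pi ≤ M := by
    refine iSup_le fun i => ?_
    rintro s ⟨t, ht, rfl⟩
    exact h i t ht
  exact fun s hs => hle s hs

lemma indist_of_atom {α : Type*} [MeasurableSpace α] {x y : α} (h : y ∈ measurableAtom x) :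
    Indist x y := by
  intro s hs
  constructor
  · exact fun hx => mem_of_mem_measurableAtom h hs hx
  · intro hy
    have : x ∈ measurableAtom y := by rw [measurableAtom_eq_of_mem h]; simp
    exact mem_of_mem_measurableAtom this hs hy

/-- `S` does not separate points of a common atom of positive mass. -/
def AtomCompat {A : Type*} [MeasurableSpace A] (p : Measure A) {m : ℕ} (S : (Fin m → A) → ℝ) :
    Prop :=
  ∀ x y : Fin m → A, (∀ j, y j ∈ measurableAtom (x j)) →
    (∀ j, p (measurableAtom (x j)) ≠ 0) → S y = S x

lemma atomCompat_of_aemeas {A : Type*} [Fintype A] [MeasurableSpace A]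
    (p : Measure A) [IsProbabilityMeasure p] {m n : ℕ} (hn : 0 < n) (j₀ : Fin m)
    {S : (Fin m → A) → ℝ} (hS0 : ∀ x, 0 ≤ S x)
    (h : AEMeasurable (optScore m n S) (wordMeasure p m n)) : AtomCompat p S := by
  intro x y hxy hx
  obtain ⟨f, hf, hae⟩ := h
  have hnull : wordMeasure p m n {w | ¬ optScore m n S w = f w} = 0 := hae
  set N := toMeasurable (wordMeasure p m n) {w | ¬ optScore m n S w = f w} with hN
  have hNm : MeasurableSet N := measurableSet_toMeasurable _ _
  have hN0 : wordMeasure p m n N = 0 := by rw [hN, measure_toMeasurable, hnull]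
  have hbox : wordMeasure p m n (Set.pi Set.univ fun j => Set.pi Set.univ fun _ =>
      measurableAtom (x j)) ≠ 0 := by
    unfold wordMeasure
    rw [Measure.pi_pi, Finset.prod_ne_zero_iff]
    intro j _
    rw [Measure.pi_pi, Finset.prod_ne_zero_iff]
    exact fun _ _ => hx j
  have key : ∀ z : Fin m → A, (∀ j, z j ∈ measurableAtom (x j)) →
      optScore m n S (fun j _ => z j) = f (fun j _ => z j) := by
    intro z hz
    by_contra hne
    have hzN : (fun j _ => z j) ∈ N := subset_toMeasurable _ _ hne
    apply hbox
    refine measure_mono_null ?_ hN0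
    intro w hw
    have hI : Indist (fun j (_ : Fin n) => z j) w := by
      refine indist_pi fun j => indist_pi fun i => indist_of_atom ?_
      rw [measurableAtom_eq_of_mem (hz j)]
      exact hw j trivial i trivial
    exact (hI N hNm).1 hzN
  have hff : f (fun j _ => y j) = f (fun j _ => x j) := by
    have hI : Indist (fun j (_ : Fin n) => x j) (fun j _ => y j) :=
      indist_pi fun j => indist_pi fun i => indist_of_atom (hxy j)
    exact (hI (f ⁻¹' {f (fun j _ => x j)}) (hf (measurableSet_singleton _))).1 rfl
  have h1 := key y hxy
  have h2 := key x (fun j => by simp)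
  rw [optScore_const hS0 j₀] at h1 h2
  have hn' : (n : ℝ) ≠ 0 := by positivity
  exact mul_left_cancel₀ hn' (by rw [h1, h2, hff])

lemma aemeas_optScoreV {A : Type*} [Fintype A] [MeasurableSpace A]
    (p : Measure A) [IsProbabilityMeasure p] {m : ℕ} (ℓ : Fin m → ℕ)
    {S : (Fin m → A) → ℝ} (hS : AtomCompat p S) :
    AEMeasurable (optScoreV m ℓ S) (wordMeasureV p ℓ) := by
  let st : Setoid A := Setoid.ker (measurableAtom (β := A))
  have hdisc : DiscreteMeasurableSpace (Quotient st) := by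
    constructor
    intro T
    rw [measurableSet_quotient]
    have : (Quotient.mk'' ⁻¹' T : Set A) =
        ⋃ a ∈ (Quotient.mk'' ⁻¹' T : Set A), measurableAtom a := by
      ext b
      simp only [Set.mem_iUnion]
      constructor
      · exact fun hb => ⟨b, hb, by simp⟩
      · rintro ⟨a, ha, hb⟩
        have : (Quotient.mk'' b : Quotient st) = Quotient.mk'' a :=
          Quotient.sound (measurableAtom_eq_of_mem hb)
        simpa only [Set.mem_preimage, this] using ha
    rw [this]
    exact MeasurableSet.biUnion (Set.to_countable _)
      fun a _ => MeasurableSet.measurableAtom_of_countable a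
  let mk : A → Quotient st := Quotient.mk''
  have hmk : Measurable mk := measurable_quotient_mk''
  have hout : ∀ a, (mk a).out ∈ measurableAtom a := by
    intro a
    have : measurableAtom (mk a).out = measurableAtom a := Quotient.mk_out (s := st) a
    rw [← this]
    simp
  let F : (∀ j : Fin m, Fin (ℓ j) → Quotient st) → ℝ :=
    fun u => optScoreV m ℓ S fun j i => (u j i).out
  have hF : Measurable F := Measurable.of_discrete
  refine ⟨fun w => F fun j i => mk (w j i), ?_, ?_⟩
  · refine hF.comp (f := fun (w : ∀ j : Fin m, Fin (ℓ j) → A) j i => mk (w j i)) ?_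
    refine measurable_pi_lambda _ fun j => measurable_pi_lambda _ fun i => hmk.comp ?_
    exact (measurable_pi_apply i).comp (measurable_pi_apply j)
  · have hG : ∀ᵐ a ∂p, p (measurableAtom a) ≠ 0 := by
      have : p (⋃ a ∈ {a | p (measurableAtom a) = 0}, measurableAtom a) = 0 :=
        (measure_biUnion_null_iff (Set.to_countable _)).2 fun a ha => ha
      refine measure_mono_null ?_ this
      intro a ha
      simp only [Set.mem_iUnion]
      exact ⟨a, by simpa using ha, by simp⟩
    have hall : ∀ᵐ w ∂(wordMeasureV p ℓ), ∀ j i, p (measurableAtom (w j i)) ≠ 0 := by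
      rw [ae_all_iff]
      intro j
      rw [ae_all_iff]
      intro i
      have h1 : ∀ᵐ u ∂(Measure.pi fun _ : Fin (ℓ j) => p), p (measurableAtom (u i)) ≠ 0 :=
        (measurePreserving_eval (fun _ : Fin (ℓ j) => p) i).quasiMeasurePreserving.ae hG
      exact (measurePreserving_eval
        (fun j => (Measure.pi fun _ : Fin (ℓ j) => p)) j).quasiMeasurePreserving.ae h1
    filter_upwards [hall] with w hw
    simp only [F, optScoreV]
    congr 1
    ext x
    refine exists_congr fun k => exists_congr fun π => and_congr_right fun _ => ?_
    have : ∀ i, S (fun j => (mk (w j (π j i))).out) = S (fun j => w j (π j i)) :=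
      fun i => hS _ _ (fun j => hout _) fun j => hw _ _
    simp only [this]

lemma int_optScoreV {A : Type*} [Fintype A] [MeasurableSpace A]
    (p : Measure A) [IsProbabilityMeasure p] {m : ℕ} (j₀ : Fin m) (ℓ : Fin m → ℕ)
    {S : (Fin m → A) → ℝ} (hS : AtomCompat p S) (hS0 : ∀ x, 0 ≤ S x)
    {s : ℝ} (hSb : ∀ x, S x ≤ s) (hs : 0 ≤ s) :
    Integrable (optScoreV m ℓ S) (wordMeasureV p ℓ) := by
  refine Integrable.of_bound (aemeas_optScoreV p ℓ hS).aestronglyMeasurable (ℓ j₀ * s)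
    (Eventually.of_forall fun w => ?_)
  rw [Real.norm_of_nonneg (optScoreV_nonneg hS0 w)]
  exact optScoreV_le hS0 hSb hs j₀ w

lemma expLV_comp {A Ω : Type*} [Fintype A] [MeasurableSpace A] [MeasurableSpace Ω]
    (p : Measure A) [IsProbabilityMeasure p] {m : ℕ} (ℓ : Fin m → ℕ)
    {S : (Fin m → A) → ℝ} (hS : AtomCompat p S) {P : Measure Ω}
    {T : Ω → ∀ j : Fin m, Fin (ℓ j) → A} (hT : MeasurePreserving T P (wordMeasureV p ℓ)) :
    ∫ w, optScoreV m ℓ S (T w) ∂P = expLV p ℓ S := by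
  unfold expLV
  rw [← hT.map_eq, integral_map hT.measurable.aemeasurable]
  rw [hT.map_eq]
  exact (aemeas_optScoreV p ℓ hS).aestronglyMeasurable

lemma expLV_super {A : Type*} [Fintype A] [MeasurableSpace A]
    (p : Measure A) [IsProbabilityMeasure p] {m : ℕ} (j₀ : Fin m) (a b : Fin m → ℕ)
    {S : (Fin m → A) → ℝ} (hS : AtomCompat p S) (hS0 : ∀ x, 0 ≤ S x)
    {s : ℝ} (hSb : ∀ x, S x ≤ s) (hs : 0 ≤ s) :
    expLV p a S + expLV p b S ≤ expLV p (fun j => a j + b j) S := by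
  have h1 := mp_rows p a (fun j => a j + b j) (fun j i => Fin.castAdd _ i)
    (fun j => Fin.castAdd_injective _ _)
  have h2 := mp_rows p b (fun j => a j + b j) (fun j i => Fin.natAdd _ i)
    (fun j => Fin.natAdd_injective _ _)
  have e1 := expLV_comp p a hS h1
  have e2 := expLV_comp p b hS h2
  have i1 := h1.integrable_comp_of_integrable (int_optScoreV p j₀ a hS hS0 hSb hs)
  have i2 := h2.integrable_comp_of_integrable (int_optScoreV p j₀ b hS hS0 hSb hs)
  have i3 := int_optScoreV p j₀ (fun j => a j + b j) hS hS0 hSb hs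
  have hpt := fun w => optScoreV_super (a := a) (b := b) hS0 hSb hs j₀ w
  have h3 := integral_mono (i1.add i2) i3 hpt
  have h4 := integral_add i1 i2
  rw [← e1, ← e2]
  exact (le_of_eq h4.symm).trans h3

lemma expLV_perm {A : Type*} [Fintype A] [MeasurableSpace A]
    (p : Measure A) [IsProbabilityMeasure p] {m : ℕ} (a : Fin m → ℕ)
    {S : (Fin m → A) → ℝ} (hS : AtomCompat p S) (hSp : PermInvariant S)
    (σ : Equiv.Perm (Fin m)) : expLV p (fun j => a (σ j)) S = expLV p a S := by
  rw [← expLV_comp p _ hS (mp_perm p a σ)]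
  unfold expLV
  exact integral_congr_ae (Eventually.of_forall fun w => optScoreV_perm hSp a σ w)

lemma expLV_nonneg {A : Type*} [MeasurableSpace A]
    (p : Measure A) {m : ℕ} (a : Fin m → ℕ)
    {S : (Fin m → A) → ℝ} (hS0 : ∀ x, 0 ≤ S x) : 0 ≤ expLV p a S :=
  integral_nonneg fun w => optScoreV_nonneg hS0 w

lemma expLV_sum {A ι : Type*} [Fintype A] [MeasurableSpace A]
    (p : Measure A) [IsProbabilityMeasure p] {m : ℕ} (j₀ : Fin m)
    {S : (Fin m → A) → ℝ} (hS : AtomCompat p S) (hS0 : ∀ x, 0 ≤ S x)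
    {s : ℝ} (hSb : ∀ x, S x ≤ s) (hs : 0 ≤ s) (t : Finset ι) (a : ι → Fin m → ℕ) :
    ∑ i ∈ t, expLV p (a i) S ≤ expLV p (fun j => ∑ i ∈ t, a i j) S := by
  induction t using Finset.induction_on with
  | empty => simpa using expLV_nonneg p _ hS0
  | insert i t hi ih =>
    simp only [Finset.sum_insert hi]
    exact (add_le_add_right ih _).trans
      (expLV_super p j₀ (a i) (fun j => ∑ i ∈ t, a i j) hS hS0 hSb hs)

lemma expLV_mul {A : Type*} [Fintype A] [MeasurableSpace A]
    (p : Measure A) [IsProbabilityMeasure p] {m : ℕ} (j₀ : Fin m)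
    {S : (Fin m → A) → ℝ} (hS : AtomCompat p S) (hS0 : ∀ x, 0 ≤ S x)
    {s : ℝ} (hSb : ∀ x, S x ≤ s) (hs : 0 ≤ s) (t : ℕ) (a : Fin m → ℕ) :
    t * expLV p a S ≤ expLV p (fun j => t * a j) S := by
  simpa using expLV_sum p j₀ hS hS0 hSb hs (Finset.range t) (fun _ => a)

lemma expLV_rot {A : Type*} [Fintype A] [MeasurableSpace A]
    (p : Measure A) [IsProbabilityMeasure p] {m : ℕ} (j₀ : Fin m)
    {S : (Fin m → A) → ℝ} (hS : AtomCompat p S) (hS0 : ∀ x, 0 ≤ S x) (hSp : PermInvariant S)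
    {s : ℝ} (hSb : ∀ x, S x ≤ s) (hs : 0 ≤ s) (a : Fin m → ℕ) :
    m * expLV p a S ≤ expL p m (∑ j, a j) S := by
  have : NeZero m := ⟨by have := j₀.2; omega⟩
  have h := expLV_sum p j₀ hS hS0 hSb hs (Finset.univ : Finset (Fin m))
    (fun i j => a (Equiv.addRight i j))
  simp only [expLV_perm p a hS hSp] at h
  have e : (fun j : Fin m => ∑ i : Fin m, a (Equiv.addRight i j)) = fun _ => ∑ j, a j := by
    ext j
    exact Equiv.sum_comp (Equiv.addLeft j) a
  rw [e] at h
  simpa [expL_eq] using h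

lemma expLV_le_gamma {A : Type*} [Fintype A] [MeasurableSpace A]
    (p : Measure A) [IsProbabilityMeasure p] {m : ℕ} (j₀ : Fin m)
    {S : (Fin m → A) → ℝ} (hS : AtomCompat p S) (hS0 : ∀ x, 0 ≤ S x) (hSp : PermInvariant S)
    {s : ℝ} (hSb : ∀ x, S x ≤ s) (hs : 0 ≤ s) {γ : ℝ}
    (hγ : Tendsto (fun n : ℕ => expL p m n S / n) atTop (nhds γ))
    (a : Fin m → ℕ) (ha : 0 < ∑ j, a j) :
    expLV p a S ≤ γ * (∑ j, a j : ℕ) / m := by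
  have hm : 0 < (m : ℝ) := by have := j₀.2; exact_mod_cast (by omega : 0 < m)
  have hrot := expLV_rot p j₀ hS hS0 hSp hSb hs a
  set M := ∑ j, a j
  have hM : (0 : ℝ) < M := by exact_mod_cast ha
  have hlim : Tendsto (fun t : ℕ => expL p m (t * M) S / (t * M : ℕ)) atTop (nhds γ) :=
    hγ.comp (tendsto_id.atTop_mul_const' ha)
  have hge : expL p m M S / M ≤ γ := by
    refine ge_of_tendsto hlim ?_
    filter_upwards [eventually_gt_atTop 0] with t ht
    have ht' : (0 : ℝ) < t := by exact_mod_cast ht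
    have := expLV_mul p j₀ hS hS0 hSb hs t (fun _ => M)
    rw [← expL_eq, ← expL_eq] at this
    push_cast
    rw [div_le_div_iff₀ hM (by positivity)]
    nlinarith
  rw [div_le_iff₀ hM] at hge
  rw [le_div_iff₀ hm]
  linarith

lemma expLV_le_delta {A : Type*} [Fintype A] [MeasurableSpace A]
    (p : Measure A) [IsProbabilityMeasure p] {m : ℕ} (j₀ : Fin m)
    {S : (Fin m → A) → ℝ} (hS : AtomCompat p S) (hS0 : ∀ x, 0 ≤ S x)
    {s : ℝ} (hSb : ∀ x, S x ≤ s) (hs : 0 ≤ s) {v : ℕ} (hv : 0 < v) (a : Fin m → ℕ) {δ : ℝ}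
    (ha : ∀ j, 0 < a j)
    (hg : Tendsto (fun n : ℕ => expLV p (fun j => ⌈(n : ℝ) * ((a j : ℝ) / v)⌉₊) S /
        ((n : ℝ) * (∑ j, (a j : ℝ) / v) / m)) atTop (nhds δ)) :
    expLV p a S ≤ δ * (∑ j, a j : ℕ) / m := by
  have hm : 0 < (m : ℝ) := by have := j₀.2; exact_mod_cast (by omega : 0 < m)
  have hv' : (0 : ℝ) < v := by exact_mod_cast hv
  have hM : (0 : ℝ) < (∑ j, a j : ℕ) := by
    exact_mod_cast Finset.sum_pos (fun j _ => ha j) ⟨j₀, Finset.mem_univ _⟩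
  have hsum : ∑ j, (a j : ℝ) / v = (∑ j, a j : ℕ) / v := by
    push_cast
    rw [Finset.sum_div]
  rw [hsum] at hg
  set M := ∑ j, a j
  have hlim := hg.comp (tendsto_id.atTop_mul_const' hv)
  have hge : expLV p a S / (M / m) ≤ δ := by
    refine ge_of_tendsto hlim ?_
    filter_upwards [eventually_gt_atTop 0] with t ht
    have ht' : (0 : ℝ) < t := by exact_mod_cast ht
    have h := expLV_mul p j₀ hS hS0 hSb hs t a
    have e : (fun j => ⌈((t * v : ℕ) : ℝ) * ((a j : ℝ) / v)⌉₊) = fun j => t * a j := by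
      ext j
      have : ((t * v : ℕ) : ℝ) * ((a j : ℝ) / v) = ((t * a j : ℕ) : ℝ) := by
        push_cast
        field_simp
      rw [this, Nat.ceil_natCast]
    simp only [Function.comp, id]
    rw [e]
    have e2 : ((t * v : ℕ) : ℝ) * ((M : ℝ) / v) / m = t * (M / m) := by
      push_cast
      field_simp
    rw [e2, div_le_div_iff₀ (by positivity) (by positivity)]
    have : (0 : ℝ) < M / m := by positivity
    nlinarith
  rw [div_le_iff₀ (by positivity)] at hge
  rw [mul_div_assoc]
  exact hge

theorem stmt13
    {A : Type*} [Fintype A] [Nonempty A] [MeasurableSpace A]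
    (p : Measure A) [IsProbabilityMeasure p]
    (m : ℕ) (hm : 2 ≤ m) (S : (Fin m → A) → ℝ) (hS0 : ∀ x, 0 ≤ S x)
    (sStar : ℝ) (hSb : ∀ x, S x ≤ sStar) (hSperm : PermInvariant S)
    (D : ℝ) (hD0 : 0 < D) (hBD : BddDiffOne S D)
    (γ δStar : ℝ)
    (hγ : Tendsto (fun n : ℕ => expL p m n S / n) atTop (nhds γ))
    (g : (Fin m → ℝ) → ℝ)
    (hg : ∀ q : Fin m → ℝ, (∀ j, 0 < q j) → q ⟨0, by omega⟩ = 1 →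
      Tendsto (fun n : ℕ => expLV p (fun j => ⌈(n : ℝ) * q j⌉₊) S /
        ((n : ℝ) * (∑ j, q j) / m)) atTop (nhds (g q)))
    (p1 p2 : Fin m → ℝ)
    (hp : ∀ j : Fin m, (j : ℕ) ≠ 0 → 0 < p1 j ∧ p1 j < 1 ∧ 1 < p2 j)
    (hoff : ∀ q : Fin m → ℝ, (∀ j, 0 < q j) → q ⟨0, by omega⟩ = 1 →
      (∃ j : Fin m, (j : ℕ) ≠ 0 ∧ (q j < p1 j ∨ p2 j < q j)) → g q ≤ δStar)
    (hδ : 0 < δStar ∧ δStar < γ)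
    (η ε : ℝ) (hη : 0 < η ∧ η < γ - δStar) (hε : 0 < ε)
    (v : ℕ) (hv1 : 1 ≤ v)
    (hv : (1 + Real.log (1 + v)) / v ≤
      η ^ 2 * ε ^ 2 / (2 * (m : ℝ) ^ 3 * ((m : ℝ) - 1) * D ^ 2)) :
    ∃ N : ℕ, ∀ (n d : ℕ) (r : Fin m → ℕ → ℕ), N ≤ n → n = v * d →
      IsDecomp m n d v r →
      (((Finset.range d).filter fun k => GoodCell m v p1 p2 r k).card : ℝ) < (1 - ε) * d →
      ∫ w, (decompScore S w d r - optScore m n S w) ∂(wordMeasure p m n) ≤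
        -(η * ε * n) / m := by
  let j₀ : Fin m := ⟨0, by omega⟩
  have hm0 : (0 : ℝ) < m := by exact_mod_cast (by omega : 0 < m)
  have hv0 : (0 : ℝ) < v := by exact_mod_cast hv1
  have hs : 0 ≤ sStar := (hS0 (fun _ => Classical.arbitrary A)).trans (hSb _)
  have hγ0 : 0 < γ := hδ.1.trans hδ.2
  have hS : AtomCompat p S := by
    obtain ⟨n, hn, hn0⟩ :=
      ((hγ.eventually (lt_mem_nhds hγ0)).and (eventually_gt_atTop 0)).exists
    refine atomCompat_of_aemeas p hn0 j₀ hS0 ?_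
    have hne : expL p m n S ≠ 0 := by
      intro h
      rw [h, zero_div] at hn
      exact lt_irrefl _ hn
    by_contra hna
    exact hne (integral_undef fun hi => hna hi.aestronglyMeasurable.aemeasurable)
  have hξ : 0 < (γ - δStar - η) * ε / m := by
    have : 0 < γ - δStar - η := by linarith [hη.2]
    positivity
  obtain ⟨N, hN⟩ := eventually_atTop.1
    (hγ.eventually (lt_mem_nhds (show γ - (γ - δStar - η) * ε / m < γ by linarith)))
  refine ⟨N, fun n d r hNn hnd hr hcard => ?_⟩
  obtain ⟨hr0, hr⟩ := hr
  -- the cell widths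
  let W : ℕ → Fin m → ℕ := fun k j => r j (k + 1) - r j k
  have hmono : ∀ k j, r j k ≤ r j (k + 1) := fun k j => (hr j).1 (Nat.le_succ k)
  have hle : ∀ k < d, ∀ j, r j (k + 1) ≤ n := fun k hk j => by
    have := (hr j).1 (show k + 1 ≤ d from hk)
    rwa [(hr j).2.2] at this
  have hcast : ∀ k j, ((W k j : ℕ) : ℝ) = (r j (k + 1) : ℝ) - r j k := fun k j =>
    Nat.cast_sub (hmono k j)
  have hW0 : ∀ k, W k j₀ = v := by
    intro k
    simp only [W, hr0 j₀ rfl]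
    rw [mul_add, mul_one, Nat.add_sub_cancel_left]
  have hWv : ∀ k, v ≤ ∑ j, W k j := fun k => by
    rw [← hW0 k]
    exact Finset.single_le_sum (f := W k) (fun _ _ => Nat.zero_le _) (Finset.mem_univ j₀)
  have htot : ∑ k ∈ Finset.range d, ((∑ j, W k j : ℕ) : ℝ) = m * n := by
    push_cast
    rw [Finset.sum_comm]
    have : ∀ j, ∑ k ∈ Finset.range d, (W k j : ℝ) = n := fun j => by
      simp only [hcast]
      rw [Finset.sum_range_sub (fun k => (r j k : ℝ)), (hr j).2.1, (hr j).2.2]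
      simp
    simp [this]
  -- expectation of one cell
  have hblock : ∀ k ∈ Finset.range d,
      Integrable (fun w => blockScore S w (fun j => r j k) (fun j => r j (k + 1)))
        (wordMeasure p m n) ∧
      ∫ w, blockScore S w (fun j => r j k) (fun j => r j (k + 1)) ∂(wordMeasure p m n) =
        expLV p (W k) S := by
    intro k hk
    rw [Finset.mem_range] at hk
    have hT := mp_rows p (W k) (fun _ => n)
      (fun j i => ⟨r j k + i, by
        have h1 := hle k hk j
        have h2 := hmono k j
        have h3 : (i : ℕ) < r j (k + 1) - r j k := i.2
        omega⟩)
      (fun j i i' h => by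
        ext
        simpa using h)
    have heq : (fun w : Fin m → Fin n → A =>
        blockScore S w (fun j => r j k) (fun j => r j (k + 1))) = _ :=
      funext fun w => blockScore_eq S w _ _ (hmono k) (hle k hk)
    rw [heq]
    exact ⟨hT.integrable_comp_of_integrable (int_optScoreV p j₀ (W k) hS hS0 hSb hs),
      expLV_comp p (W k) hS hT⟩
  have hcell : ∀ k ∈ Finset.range d, expLV p (W k) S ≤ γ * ((∑ j, W k j : ℕ) : ℝ) / m -
      (if ¬ GoodCell m v p1 p2 r k then (γ - δStar) * v / m else 0) := by
    intro k _
    by_cases hk : GoodCell m v p1 p2 r k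
    · simp only [hk, not_true_eq_false, if_false, sub_zero]
      exact expLV_le_gamma p j₀ hS hS0 hSperm hSb hs hγ _ (hv1.trans (hWv k))
    · simp only [hk, not_false_eq_true, if_true]
      have hWv' : (v : ℝ) ≤ ((∑ j, W k j : ℕ) : ℝ) := by exact_mod_cast hWv k
      have hbad : expLV p (W k) S ≤ δStar * ((∑ j, W k j : ℕ) : ℝ) / m := by
        by_cases hz : ∀ j, 0 < W k j
        · have hq0 : (W k j₀ : ℝ) / v = 1 := by
            rw [hW0 k]
            exact div_self hv0.ne'
          have hqp : ∀ j, 0 < (W k j : ℝ) / v := fun j => by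
            have : (0 : ℝ) < W k j := by exact_mod_cast hz j
            positivity
          have h1 := expLV_le_delta p j₀ hS hS0 hSb hs hv1 (W k) hz
            (hg (fun j => (W k j : ℝ) / v) hqp hq0)
          have h2 : g (fun j => (W k j : ℝ) / v) ≤ δStar := by
            refine hoff _ hqp hq0 ?_
            unfold GoodCell at hk
            push Not at hk
            obtain ⟨j, hj, h⟩ := hk
            refine ⟨j, hj, ?_⟩
            rw [div_lt_iff₀ hv0, lt_div_iff₀ hv0, hcast]
            by_cases hc : (v : ℝ) * p1 j ≤ (r j (k + 1) : ℝ) - (r j k : ℝ)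
            · right
              linarith [h hc]
            · left
              linarith
          refine h1.trans ?_
          gcongr
        · push Not at hz
          obtain ⟨j, hj⟩ := hz
          have hj0 : W k j = 0 := by omega
          have : expLV p (W k) S ≤ 0 := by
            refine integral_nonpos fun w => ?_
            have := optScoreV_le hS0 hSb hs j w
            simpa [hj0] using this
          refine this.trans ?_
          have := hδ.1
          positivity
      refine hbad.trans ?_
      rw [← sub_div]
      gcongr
      nlinarith [hδ.2]
  have hbadcard : ε * d ≤ (((Finset.range d).filter fun k => ¬ GoodCell m v p1 p2 r k).card : ℝ) := by
    have h := Finset.card_filter_add_card_filter_not (s := Finset.range d)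
      (fun k => GoodCell m v p1 p2 r k)
    rw [Finset.card_range] at h
    have h' : (((Finset.range d).filter fun k => GoodCell m v p1 p2 r k).card : ℝ) +
      (((Finset.range d).filter fun k => ¬ GoodCell m v p1 p2 r k).card : ℝ) = d := by
      exact_mod_cast h
    linarith
  have hsumle : ∑ k ∈ Finset.range d, expLV p (W k) S ≤
      γ * n - ε * d * ((γ - δStar) * v / m) := by
    refine (Finset.sum_le_sum hcell).trans ?_
    rw [Finset.sum_sub_distrib, ← Finset.sum_div, ← Finset.mul_sum, htot, ← Finset.sum_filter,
      Finset.sum_const, nsmul_eq_mul]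
    have e : γ * (m * n) / m = γ * (n : ℝ) := by field_simp
    rw [e]
    have : 0 ≤ (γ - δStar) * v / m := by
      have : 0 ≤ γ - δStar := by linarith [hδ.2]
      positivity
    gcongr
  have hd0 : 0 < d := by
    rcases Nat.eq_zero_or_pos d with h | h
    · subst h
      simp at hcard
    · exact h
  have hn0 : (0 : ℝ) < n := by
    have : 0 < n := by rw [hnd]; positivity
    exact_mod_cast this
  have hL := hN n hNn
  rw [lt_div_iff₀ hn0] at hL
  have hdI : Integrable (fun w => decompScore S w d r) (wordMeasure p m n) := by
    unfold decompScore
    exact integrable_finsetSum _ fun k hk => (hblock k hk).1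
  have hoI : Integrable (fun w => optScore m n S w) (wordMeasure p m n) :=
    int_optScoreV p j₀ (fun _ => n) hS hS0 hSb hs
  rw [integral_sub hdI hoI]
  have hdE : ∫ w, decompScore S w d r ∂(wordMeasure p m n) =
      ∑ k ∈ Finset.range d, expLV p (W k) S := by
    unfold decompScore
    rw [integral_finsetSum _ fun k hk => (hblock k hk).1]
    exact Finset.sum_congr rfl fun k hk => (hblock k hk).2
  rw [hdE]
  change _ - expL p m n S ≤ _
  have hnd' : (n : ℝ) = v * d := by exact_mod_cast hnd
  have e1 : ε * d * ((γ - δStar) * v / m) = (γ - δStar) * ε * n / m := by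
    rw [hnd']; ring
  rw [e1] at hsumle
  have e2 : (γ - (γ - δStar - η) * ε / m) * n =
      γ * n - (γ - δStar) * ε * n / m + η * ε * n / m := by ring
  rw [e2] at hL
  rw [neg_div]
  linarith
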